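/- Let 1 < c < 2. There exist C > 0 and N₀ such that for all real N ≥ N₀ the following holds: set X = (1/2)(2N/5)^{1/c}, ε = (log X)^{−2}, r = ⌊log X⌋, let φ: ℝ → ℝ be any r times continuously differentiable function with φ(y) = 1 for |y| ≤ 4ε/5, 0 < φ(y) < 1 for 4ε/5 < |y| < ε, φ(y) = 0 for |y| ≥ ε, and let Φ(x) = ∫_{−∞}^{+∞} e(−xy) φ(y) dy be its Fourier transform. Then the real part of ∫_{−∞}^{+∞} I(x)⁴ Φ(x) e(−Nx) dx is at least C · ε · X^{4−c} (and in fact this integral is real). -/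

import Mathlib

/-- `e(y) = e^{2πiy}`. -/
noncomputable def e (y : ℝ) : ℂ := Complex.exp (2 * Real.pi * Complex.I * y)

/-- `I(x) = ∫_X^{2X} e(t^c x) dt`. -/
noncomputable def I (c X x : ℝ) : ℂ :=
  ∫ t in X..(2 * X), e (t ^ c * x)

open MeasureTheory Set Filter Topology
open scoped FourierTransform

theorem norm_e (y : ℝ) : ‖e y‖ = 1 := by
  have : (2 * Real.pi * Complex.I * y : ℂ) = ((2 * Real.pi * y : ℝ) : ℂ) * Complex.I := by
    push_cast; ring
  rw [e, this, Complex.norm_exp_ofReal_mul_I]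

theorem e_add (x y : ℝ) : e (x + y) = e x * e y := by
  rw [e, e, e, ← Complex.exp_add]
  push_cast
  ring_nf

theorem continuous_e : Continuous e := by
  unfold e
  fun_prop

/-- The Fourier transform of a compactly supported `C²` function is integrable. -/
theorem integrable_fourier_of_contDiff_two {f : ℝ → ℂ} (hf : ContDiff ℝ 2 f)
    (hs : HasCompactSupport f) : Integrable (𝓕 f) := by
  have hfi : Integrable f := hf.continuous.integrable_of_hasCompactSupport hs
  have hd1 : ContDiff ℝ 1 (deriv f) := by
    have : ContDiff ℝ (1 + 1) f := by simpa [one_add_one_eq_two] using hf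
    exact (contDiff_succ_iff_deriv.1 this).2.2
  have hd2 : Continuous (deriv (deriv f)) := hd1.continuous_deriv le_rfl
  have hi1 : Integrable (deriv f) := hd1.continuous.integrable_of_hasCompactSupport hs.deriv
  have hi2 : Integrable (deriv (deriv f)) := hd2.integrable_of_hasCompactSupport hs.deriv.deriv
  have h1 := Real.fourier_deriv hfi (hf.differentiable (by norm_num)) hi1
  have h2 := Real.fourier_deriv hi1 (hd1.differentiable (by norm_num)) hi2
  have bound (g : ℝ → ℂ) (x : ℝ) : ‖𝓕 g x‖ ≤ ∫ y, ‖g y‖ :=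
    VectorFourier.norm_fourierIntegral_le_integral_norm _ _ _ _ _
  set A := ∫ y, ‖f y‖
  set B := ∫ y, ‖deriv (deriv f) y‖
  have hcont : Continuous (𝓕 f) :=
    VectorFourier.fourierIntegral_continuous Real.continuous_fourierChar (by fun_prop) hfi
  refine ((integrable_inv_one_add_sq).const_mul (A + B)).mono' hcont.aestronglyMeasurable
    (Eventually.of_forall fun x => ?_)
  have hB := bound (deriv (deriv f)) x
  rw [h2, h1] at hB
  have hA := bound f x
  simp only [norm_smul, norm_mul, Complex.norm_real, Complex.norm_I, Complex.norm_ofNat,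
    Real.norm_eq_abs, abs_of_pos Real.pi_pos] at hB
  have hpi := Real.pi_gt_three
  rw [← div_eq_mul_inv, le_div_iff₀ (by positivity)]
  have hx : x ^ 2 = |x| * |x| := by rw [← sq, sq_abs]
  have hle : |x| * |x| * ‖𝓕 f x‖ ≤ B := by
    refine le_trans ?_ hB
    have : (1 : ℝ) ≤ 4 * (Real.pi * Real.pi) := by nlinarith
    have h0 : 0 ≤ |x| * |x| * ‖𝓕 f x‖ := by positivity
    nlinarith
  rw [hx]
  linarith

/-- Fourier inversion in the normalisation of `e`. -/
theorem integrable_and_integral_mul_e_eq {φ : ℝ → ℝ} (hφ : ContDiff ℝ 2 φ)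
    (hs : HasCompactSupport φ) {Φ : ℝ → ℂ}
    (hΦ : ∀ x : ℝ, Φ x = ∫ y : ℝ, e (-(x * y)) * (φ y : ℂ)) :
    Integrable Φ ∧ ∀ s : ℝ, ∫ x, Φ x * e (s * x) = (φ s : ℂ) := by
  set f : ℝ → ℂ := fun y => (φ y : ℂ) with hfdef
  have hf : ContDiff ℝ 2 f := Complex.ofRealCLM.contDiff.comp hφ
  have hfs : HasCompactSupport f := hs.comp_left Complex.ofReal_zero
  have hΦf : Φ = 𝓕 f := by
    ext x
    rw [hΦ, Real.fourier_real_eq_integral_exp_smul]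
    refine integral_congr_ae (Eventually.of_forall fun y => ?_)
    simp only [e, smul_eq_mul, hfdef]
    congr 2
    push_cast
    ring
  have hint : Integrable Φ := hΦf ▸ integrable_fourier_of_contDiff_two hf hfs
  refine ⟨hint, fun s => ?_⟩
  have hinv := hf.continuous.fourierInv_fourier_eq
    (hf.continuous.integrable_of_hasCompactSupport hfs) (hΦf ▸ hint)
  rw [← hΦf] at hinv
  change _ = f s
  rw [← hinv, Real.fourierInv_eq']
  refine integral_congr_ae (Eventually.of_forall fun x => ?_)
  simp only [e, smul_eq_mul]
  rw [mul_comm]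
  congr 2
  simp only [RCLike.inner_apply, conj_trivial]
  push_cast
  ring

/-- The sum `t₁ᶜ + t₂ᶜ + t₃ᶜ + t₄ᶜ`, with the variables grouped as `((t₁, t₂, t₃), t₄)`. -/
noncomputable def powerSum (c : ℝ) (t : (ℝ × ℝ × ℝ) × ℝ) : ℝ :=
  t.1.1 ^ c + t.1.2.1 ^ c + t.1.2.2 ^ c + t.2 ^ c

theorem measurable_powerSum (c : ℝ) : Measurable (powerSum c) := by
  unfold powerSum
  fun_prop

/-- Lebesgue measure on `(X, 2X]`. -/
noncomputable def intervalMeasure (X : ℝ) : Measure ℝ := volume.restrict (Ioc X (2 * X))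

instance (X : ℝ) : IsFiniteMeasure (intervalMeasure X) := by
  unfold intervalMeasure
  infer_instance

/-- The product measure on the box `(X, 2X]⁴`. -/
noncomputable def boxMeasure (X : ℝ) : Measure ((ℝ × ℝ × ℝ) × ℝ) :=
  ((intervalMeasure X).prod ((intervalMeasure X).prod (intervalMeasure X))).prod
    (intervalMeasure X)

instance (X : ℝ) : IsFiniteMeasure (boxMeasure X) := by
  unfold boxMeasure
  infer_instance

theorem I_pow_four {c X : ℝ} (hX : 0 ≤ X) (x : ℝ) :
    I c X x ^ 4 = ∫ t, e (powerSum c t * x) ∂boxMeasure X := by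
  have hI : I c X x = ∫ t, e (t ^ c * x) ∂intervalMeasure X := by
    rw [I, intervalIntegral.integral_of_le (by linarith), intervalMeasure]
  have h3 : ∫ t : ℝ × ℝ × ℝ, e (t.1 ^ c * x) * (e (t.2.1 ^ c * x) * e (t.2.2 ^ c * x))
      ∂(intervalMeasure X).prod ((intervalMeasure X).prod (intervalMeasure X)) = I c X x ^ 3 := by
    rw [integral_prod_mul (fun t => e (t ^ c * x))
      (fun t : ℝ × ℝ => e (t.1 ^ c * x) * e (t.2 ^ c * x)),
      integral_prod_mul (fun t => e (t ^ c * x)) (fun t => e (t ^ c * x)), ← hI]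
    ring
  rw [pow_succ, ← h3]
  nth_rw 1 [hI]
  rw [boxMeasure, ← integral_prod_mul]
  refine integral_congr_ae (Eventually.of_forall fun t => ?_)
  simp only [powerSum, add_mul, e_add]
  ring

theorem integral_I_pow_four_mul {c X N : ℝ} (hX : 0 ≤ X) {φ : ℝ → ℝ} {Φ : ℝ → ℂ}
    (hΦ : Integrable Φ) (hinv : ∀ s : ℝ, ∫ x, Φ x * e (s * x) = (φ s : ℂ)) :
    ∫ x, I c X x ^ 4 * Φ x * e (-(N * x)) =
      ((∫ t, φ (powerSum c t - N) ∂boxMeasure X : ℝ) : ℂ) := by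
  have hF (x : ℝ) : I c X x ^ 4 * Φ x * e (-(N * x)) =
      ∫ t, Φ x * e ((powerSum c t - N) * x) ∂boxMeasure X := by
    rw [I_pow_four hX, mul_assoc, ← integral_mul_const]
    refine integral_congr_ae (Eventually.of_forall fun t => ?_)
    have h : (powerSum c t - N) * x = powerSum c t * x + -(N * x) := by ring
    beta_reduce
    rw [h, e_add]
    ring
  have hmeas : Measurable fun p : ℝ × ((ℝ × ℝ × ℝ) × ℝ) => e ((powerSum c p.2 - N) * p.1) :=
    continuous_e.measurable.comp
      ((((measurable_powerSum c).comp measurable_snd).sub_const N).mul measurable_fst)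
  have hint : Integrable (Function.uncurry fun (x : ℝ) t => Φ x * e ((powerSum c t - N) * x))
      (volume.prod (boxMeasure X)) :=
    (hΦ.comp_fst (boxMeasure X)).mul_bdd (c := 1) hmeas.aestronglyMeasurable
      (Eventually.of_forall fun p => (norm_e _).le)
  simp_rw [hF]
  rw [integral_integral_swap hint, ← integral_complex_ofReal]
  exact integral_congr_ae (Eventually.of_forall fun t => hinv _)

theorem measureReal_le_integral_of_eq_one {α : Type*} [MeasurableSpace α] {μ : Measure α}
    [IsFiniteMeasure μ] {f : α → ℝ} (hf : Measurable f) (h0 : ∀ a, 0 ≤ f a) (h1 : ∀ a, f a ≤ 1)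
    {s : Set α} (hs : MeasurableSet s) (hfs : ∀ a ∈ s, f a = 1) : μ.real s ≤ ∫ a, f a ∂μ := by
  have hi : Integrable f μ := (integrable_const (1 : ℝ)).mono' hf.aestronglyMeasurable
    (Eventually.of_forall fun a => by rw [Real.norm_of_nonneg (h0 a)]; exact h1 a)
  rw [← integral_indicator_one hs]
  refine integral_mono ((integrable_const (1 : ℝ)).indicator hs) hi fun a => ?_
  by_cases ha : a ∈ s
  · simp [ha, hfs a ha]
  · simp [ha, h0 a]

theorem rpow_add_sub_rpow_le {c s δ : ℝ} (hc : 1 ≤ c) (hs : 0 < s) (hδ : 0 ≤ δ) :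
    (s + δ) ^ c - s ^ c ≤ c * (s + δ) ^ (c - 1) * δ := by
  rcases hδ.eq_or_lt with rfl | hδ
  · simp
  have := (convexOn_rpow hc).slope_le_of_hasDerivAt (x := s) (y := s + δ) (mem_Ici.2 hs.le)
    (mem_Ici.2 (by linarith)) (by linarith) (Real.hasDerivAt_rpow_const (Or.inl (by linarith)))
  rw [slope_def_field, div_le_iff₀ (by linarith)] at this
  simpa using this

/-- For `s` well inside `[Xᶜ, (2X)ᶜ]`, the `t ∈ (X, 2X]` with `|tᶜ - s| ≤ η` have measure
`≫ η X^{1-c}`. -/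
theorem le_measure_slice {c X η s : ℝ} (hc1 : 1 < c) (hc2 : c < 2) (hX : 1 ≤ X) (hη : 0 ≤ η)
    (hη1 : η ≤ 3 / 10) (hs1 : 11 / 20 * (2 * X) ^ c ≤ s) (hs2 : s ≤ 7 / 10 * (2 * X) ^ c) :
    ENNReal.ofReal (η / (c * (2 * X) ^ (c - 1))) ≤
      intervalMeasure X {t | |t ^ c - s| ≤ η} := by
  have hX0 : 0 < 2 * X := by linarith
  have hM : 0 < (2 * X) ^ c := Real.rpow_pos_of_pos hX0 c
  have hs0 : 0 < s := by linarith [mul_pos (by norm_num : (0 : ℝ) < 11 / 20) hM]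
  have hP : 1 ≤ (2 * X) ^ (c - 1) := Real.one_le_rpow (by linarith) (by linarith)
  set δ := η / (c * (2 * X) ^ (c - 1)) with hδ
  have hcP : 1 ≤ c * (2 * X) ^ (c - 1) := by nlinarith
  have hδ0 : 0 ≤ δ := by positivity
  have hδη : δ ≤ η := div_le_self hη hcP
  set t₀ := s ^ c⁻¹ with ht₀
  have ht₀c : t₀ ^ c = s := Real.rpow_inv_rpow hs0.le (by linarith)
  have ht₀0 : 0 < t₀ := Real.rpow_pos_of_pos hs0 _
  have h1 : X < t₀ := by
    by_contra! h
    have h2 : t₀ ^ c ≤ (1 / 2 * (2 * X)) ^ c :=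
      Real.rpow_le_rpow ht₀0.le (by linarith) (by linarith)
    rw [Real.mul_rpow (by norm_num) hX0.le, ht₀c] at h2
    have h3 : (1 / 2 : ℝ) ^ c ≤ (1 / 2) ^ (1 : ℝ) :=
      Real.rpow_le_rpow_of_exponent_ge (by norm_num) (by norm_num) hc1.le
    rw [Real.rpow_one] at h3
    nlinarith
  have h2 : t₀ ≤ 17 / 20 * (2 * X) := by
    by_contra! h
    have h2 : (17 / 20 * (2 * X)) ^ c < t₀ ^ c :=
      Real.rpow_lt_rpow (by linarith) h (by linarith)
    rw [Real.mul_rpow (by norm_num) hX0.le, ht₀c] at h2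
    have h3 : (17 / 20 : ℝ) ^ (2 : ℝ) ≤ (17 / 20) ^ c :=
      Real.rpow_le_rpow_of_exponent_ge (by norm_num) (by norm_num) hc2.le
    norm_num at h3
    nlinarith
  have hsub : Icc t₀ (t₀ + δ) ⊆ {t | |t ^ c - s| ≤ η} ∩ Ioc X (2 * X) := by
    rintro t ⟨hl, hr⟩
    have htX : t ≤ 2 * X := by linarith
    refine ⟨?_, by linarith, htX⟩
    have hlow : s ≤ t ^ c := ht₀c ▸ Real.rpow_le_rpow ht₀0.le hl (by linarith)
    have hup := rpow_add_sub_rpow_le hc1.le ht₀0 (sub_nonneg.2 hl)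
    rw [add_sub_cancel, ht₀c] at hup
    rw [mem_ofPred_eq, abs_of_nonneg (by linarith)]
    have hP' : t ^ (c - 1) ≤ (2 * X) ^ (c - 1) :=
      Real.rpow_le_rpow (by linarith) htX (by linarith)
    calc t ^ c - s ≤ c * t ^ (c - 1) * (t - t₀) := hup
      _ ≤ c * (2 * X) ^ (c - 1) * δ := by
        gcongr
        linarith
      _ = η := by rw [hδ]; field_simp
  calc ENNReal.ofReal δ = volume (Icc t₀ (t₀ + δ)) := by rw [Real.volume_Icc]; congr 1; ring
    _ ≤ volume ({t | |t ^ c - s| ≤ η} ∩ Ioc X (2 * X)) := measure_mono hsub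
    _ ≤ _ := Measure.le_restrict_apply _ _

theorem le_boxMeasure {c X η N : ℝ} (hc1 : 1 < c) (hc2 : c < 2) (hX : 1 ≤ X) (hη : 0 ≤ η)
    (hη1 : η ≤ 3 / 10) (hN : N = 5 / 2 * (2 * X) ^ c) :
    (2 * X * ((13 / 20) ^ c⁻¹ - (3 / 5) ^ c⁻¹)) ^ 3 * (η / (c * (2 * X) ^ (c - 1))) ≤
      (boxMeasure X).real {t | |powerSum c t - N| ≤ η} := by
  have hc0 : 0 < c := by linarith
  have hX0 : 0 < 2 * X := by linarith
  have hM : 0 < (2 * X) ^ c := Real.rpow_pos_of_pos hX0 c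
  set a : ℝ := (3 / 5) ^ c⁻¹ with ha
  set b : ℝ := (13 / 20) ^ c⁻¹ with hb
  have hac : a ^ c = 3 / 5 := Real.rpow_inv_rpow (by norm_num) hc0.ne'
  have hbc : b ^ c = 13 / 20 := Real.rpow_inv_rpow (by norm_num) hc0.ne'
  have ha0 : 1 / 2 < a := by
    have h : (3 / 5 : ℝ) ^ (1 : ℝ) ≤ (3 / 5) ^ c⁻¹ :=
      Real.rpow_le_rpow_of_exponent_ge (by norm_num) (by norm_num) (inv_le_one_of_one_le₀ hc1.le)
    rw [Real.rpow_one] at h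
    linarith
  have hb1 : b ≤ 1 := Real.rpow_le_one (by norm_num) (by norm_num) (by positivity)
  have hab : a ≤ b := Real.rpow_le_rpow (by norm_num) (by norm_num) (by positivity)
  set J : Set ℝ := Icc (2 * X * a) (2 * X * b) with hJ
  have hJpow {t : ℝ} (ht : t ∈ J) :
      3 / 5 * (2 * X) ^ c ≤ t ^ c ∧ t ^ c ≤ 13 / 20 * (2 * X) ^ c := by
    have hl := Real.rpow_le_rpow (by positivity) ht.1 hc0.le
    have hr := Real.rpow_le_rpow ((by positivity : 0 ≤ 2 * X * a).trans ht.1) ht.2 hc0.le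
    rw [Real.mul_rpow hX0.le (by linarith)] at hl hr
    rw [hac] at hl
    rw [hbc] at hr
    constructor <;> linarith
  have hJv : intervalMeasure X J = ENNReal.ofReal (2 * X * (b - a)) := by
    rw [intervalMeasure, Measure.restrict_apply measurableSet_Icc, inter_eq_left.2, Real.volume_Icc,
      mul_sub]
    rintro t ⟨hl, hr⟩
    constructor <;> nlinarith
  have hba : 0 ≤ 2 * X * (b - a) := mul_nonneg hX0.le (by linarith)
  have hmeas : MeasurableSet {t | |powerSum c t - N| ≤ η} :=
    measurableSet_le (((measurable_powerSum c).sub_const N).abs) measurable_const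
  rw [measureReal_def, ← ENNReal.ofReal_le_iff_le_toReal (measure_ne_top _ _), boxMeasure,
    Measure.prod_apply hmeas]
  set ν := intervalMeasure X with hν
  set δ := η / (c * (2 * X) ^ (c - 1))
  have hB : MeasurableSet (J ×ˢ J ×ˢ J) :=
    measurableSet_Icc.prod (measurableSet_Icc.prod measurableSet_Icc)
  calc ENNReal.ofReal ((2 * X * (b - a)) ^ 3 * δ)
      = ENNReal.ofReal δ * (ν.prod (ν.prod ν)) (J ×ˢ J ×ˢ J) := by
        rw [Measure.prod_prod, Measure.prod_prod, hJv, mul_comm, ENNReal.ofReal_mul' (by positivity),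
          ENNReal.ofReal_pow hba]
        ring
    _ = ∫⁻ _ in J ×ˢ J ×ˢ J, ENNReal.ofReal δ ∂(ν.prod (ν.prod ν)) := by
        rw [setLIntegral_const]
    _ ≤ ∫⁻ u in J ×ˢ J ×ˢ J, ν (Prod.mk u ⁻¹' {t | |powerSum c t - N| ≤ η})
          ∂(ν.prod (ν.prod ν)) := by
        refine setLIntegral_mono' hB fun u hu => ?_
        obtain ⟨h1l, h1r⟩ := hJpow hu.1
        obtain ⟨h2l, h2r⟩ := hJpow hu.2.1
        obtain ⟨h3l, h3r⟩ := hJpow hu.2.2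
        convert! le_measure_slice (s := N - (u.1 ^ c + u.2.1 ^ c + u.2.2 ^ c)) hc1 hc2 hX hη hη1
          (by linarith) (by linarith) using 2
        ext t
        simp only [powerSum, mem_preimage, mem_ofPred_eq]
        ring_nf
    _ ≤ _ := setLIntegral_le_lintegral _ _

theorem main_term_lower_bound
    (c : ℝ) (hc1 : 1 < c) (hc2 : c < 2) :
    ∃ C : ℝ, 0 < C ∧ ∃ N₀ : ℝ, ∀ N : ℝ, N₀ ≤ N →
      ∀ X ε : ℝ, X = (1 / 2) * (2 * N / 5) ^ (1 / c) → ε = ((Real.log X) ^ 2)⁻¹ →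
        ∀ φ : ℝ → ℝ, ContDiff ℝ (⌊Real.log X⌋₊ : ℕ∞) φ →
          (∀ y : ℝ, |y| ≤ 4 * ε / 5 → φ y = 1) →
          (∀ y : ℝ, 4 * ε / 5 < |y| → |y| < ε → 0 < φ y ∧ φ y < 1) →
          (∀ y : ℝ, ε ≤ |y| → φ y = 0) →
          ∀ Φ : ℝ → ℂ, (∀ x : ℝ, Φ x = ∫ y : ℝ, e (-(x * y)) * (φ y : ℂ)) →
            C * ε * X ^ (4 - c) ≤ (∫ x : ℝ, I c X x ^ 4 * Φ x * e (-(N * x))).re ∧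
            (∫ x : ℝ, I c X x ^ 4 * Φ x * e (-(N * x))).im = 0 := by
  have hc0 : 0 < c := by linarith
  set κ : ℝ := (13 / 20) ^ c⁻¹ - (3 / 5) ^ c⁻¹ with hκ
  have hκ0 : 0 < κ := sub_pos.2 (Real.rpow_lt_rpow (by norm_num) (by norm_num) (by positivity))
  have hlim : Tendsto (fun N : ℝ => (1 / 2) * (2 * N / 5) ^ (1 / c)) atTop atTop := by
    refine Tendsto.const_mul_atTop (by norm_num)
      ((tendsto_rpow_atTop (by positivity)).comp ?_)
    exact (tendsto_id.const_mul_atTop two_pos).atTop_div_const (by norm_num)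
  obtain ⟨N₀, hN₀⟩ := eventually_atTop.1
    ((hlim.eventually_ge_atTop (Real.exp 2)).and (eventually_ge_atTop 0))
  refine ⟨(2 * κ) ^ 3 * (4 / 5) / (c * 2 ^ (c - 1)), by positivity, N₀, ?_⟩
  intro N hN X ε hX hε φ hφ hφ1 hφ2 hφ3 Φ hΦ
  obtain ⟨hXe, hN0⟩ := hN₀ N hN
  rw [← hX] at hXe
  have hX0 : 0 < X := (Real.exp_pos 2).trans_le hXe
  have hX1 : 1 ≤ X := (Real.one_le_exp (by norm_num)).trans hXe
  have hlog : 2 ≤ Real.log X := (Real.le_log_iff_exp_le hX0).2 hXe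
  have hε0 : 0 < ε := hε ▸ by positivity
  have hε1 : ε ≤ 1 / 4 := by
    rw [hε, one_div]
    exact inv_anti₀ (by norm_num) (by nlinarith)
  have hNX : N = 5 / 2 * (2 * X) ^ c := by
    rw [hX, ← mul_assoc]
    norm_num
    rw [Real.rpow_inv_rpow (by positivity) hc0.ne']
    ring
  have hφC : ContDiff ℝ 2 φ := hφ.of_le (by
    have : 2 ≤ ⌊Real.log X⌋₊ := Nat.le_floor (by exact_mod_cast hlog)
    exact WithTop.coe_le_coe.2 (Nat.cast_le.2 this : ((2 : ℕ) : ℕ∞) ≤ _))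
  have hφs : HasCompactSupport φ := HasCompactSupport.intro' (K := Icc (-ε) ε) isCompact_Icc
    isClosed_Icc fun y hy => hφ3 y (by
      by_contra! h
      exact hy ⟨(abs_lt.1 h).1.le, (abs_lt.1 h).2.le⟩)
  have hφ01 (y : ℝ) : 0 ≤ φ y ∧ φ y ≤ 1 := by
    rcases le_or_gt |y| (4 * ε / 5) with h | h
    · simp [hφ1 y h]
    · rcases lt_or_ge |y| ε with h' | h'
      · exact ⟨(hφ2 y h h').1.le, (hφ2 y h h').2.le⟩
      · simp [hφ3 y h']
  obtain ⟨hΦi, hinv⟩ := integrable_and_integral_mul_e_eq hφC hφs hΦ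
  rw [integral_I_pow_four_mul hX0.le hΦi hinv, Complex.ofReal_re, Complex.ofReal_im]
  refine ⟨?_, rfl⟩
  have hmeas := (measurable_powerSum c).sub_const N
  refine le_trans ?_ ((le_boxMeasure hc1 hc2 hX1 (η := 4 * ε / 5) (by positivity) (by linarith)
    hNX).trans (measureReal_le_integral_of_eq_one (hφC.continuous.measurable.comp hmeas)
      (fun t => (hφ01 _).1) (fun t => (hφ01 _).2) (measurableSet_le hmeas.abs measurable_const)
      fun t ht => hφ1 _ ht))
  refine le_of_eq ?_
  have hpow : X ^ (4 - c) = X ^ 3 / X ^ (c - 1) := by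
    rw [← Real.rpow_natCast, ← Real.rpow_sub hX0]
    congr 1
    push_cast
    ring
  rw [hpow, Real.mul_rpow (by norm_num) hX0.le, ← hκ]
  have := (Real.rpow_pos_of_pos hX0 (c - 1)).ne'
  field_simp
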